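/- Fix q with 3 ≤ q ≤ 4 and suppose the third derivative of f is Hölder continuous of degree ν = q − 3 with constant M_q = L_{3,q−3} < ∞. Let x ∈ dom ψ, s ∈ ∂ψ(x), and g := ‖∇f(x) + s‖ > 0. Choose α with (q − 2)/(q − 1) ≤ α ≤ 1 and H ≥ (6^{q−2} M_q/(4^{q−3}(q − 2)))^{1/(q−1)} · (1/g)^{α − (q−2)/(q−1)}, set λ := H g^α, and let T be a regularized Newton step from x with parameter λ. Then ⟨F'(T), x − T⟩ ≥ ‖F'(T)‖² / (4λ). -/

import Mathlib

open Set
open scoped RealInnerProductSpace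

/-- `v` is a subgradient of `ψ` at `x`. -/
def IsSubgradAt {E : Type*} [NormedAddCommGroup E] [InnerProductSpace ℝ E]
    (ψ : E → ℝ) (v x : E) : Prop :=
  ∀ y, ψ x + ⟪v, y - x⟫ ≤ ψ y

lemma aux_smul {E : Type*} [NormedAddCommGroup E] [InnerProductSpace ℝ E]
    (A : ContinuousMultilinearMap ℝ (fun _ : Fin 3 => E) ℝ) (t : ℝ) (u h v : E) :
    A ![t • u, h, v] = t * A ![u, h, v] := by
  have := A.map_update_smul ![u, h, v] 0 t u
  have e : ∀ z : E, Function.update ![u, h, v] 0 z = ![z, h, v] := by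
    intro z
    ext i
    fin_cases i <;> rfl
  rw [e, e, smul_eq_mul] at this
  exact this

lemma aux_hess {E : Type*} [NormedAddCommGroup E] [InnerProductSpace ℝ E] [CompleteSpace E]
    (f : E → ℝ) (g : E → E) (hg : ∀ y, HasGradientAt f (g y) y)
    (hess : E → E →L[ℝ] E) (hhess : ∀ y, HasFDerivAt g (hess y) y) (y h v : E) :
    iteratedFDeriv ℝ 2 f y ![h, v] = ⟪hess y h, v⟫ := by
  have h1 : fderiv ℝ f = fun z => innerSL ℝ (g z) := by
    funext z
    rw [(hg z).hasFDerivAt.fderiv]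
    ext w
    simp
  rw [iteratedFDeriv_two_apply, h1]
  have h2 : HasFDerivAt (fun z => innerSL ℝ (g z)) ((innerSL ℝ (E := E)).comp (hess y)) y :=
    (innerSL ℝ (E := E)).hasFDerivAt.comp y (hhess y)
  rw [h2.fderiv]
  simp

lemma aux_line {E : Type*} [NormedAddCommGroup E] [InnerProductSpace ℝ E] (x u : E) (t : ℝ) :
    HasDerivAt (fun t : ℝ => x + t • u) u t := by
  simpa using ((hasDerivAt_id t).smul_const u).const_add x

lemma aux_d1 {E : Type*} [NormedAddCommGroup E] [InnerProductSpace ℝ E]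
    (g : E → E) (hess : E → E →L[ℝ] E) (hhess : ∀ y, HasFDerivAt g (hess y) y) (x h v : E)
    (t : ℝ) :
    HasDerivAt (fun t : ℝ => ⟪g (x + t • h), v⟫) ⟪hess (x + t • h) h, v⟫ t := by
  have := ((hhess (x + t • h)).comp_hasDerivAt t (aux_line x h t))
  simpa using this.inner ℝ (hasDerivAt_const t v)

lemma aux_d2 {E : Type*} [NormedAddCommGroup E] [InnerProductSpace ℝ E] [CompleteSpace E]
    (f : E → ℝ) (hf3 : ContDiff ℝ 3 f) (g : E → E) (hg : ∀ y, HasGradientAt f (g y) y)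
    (hess : E → E →L[ℝ] E) (hhess : ∀ y, HasFDerivAt g (hess y) y) (x u h v : E) (t : ℝ) :
    HasDerivAt (fun t : ℝ => ⟪hess (x + t • u) h, v⟫)
      (iteratedFDeriv ℝ 3 f (x + t • u) ![u, h, v]) t := by
  have hd : DifferentiableAt ℝ (iteratedFDeriv ℝ 2 f) (x + t • u) :=
    (hf3.differentiable_iteratedFDeriv (m := 2) (by norm_cast)) _
  have h1 := (hd.hasFDerivAt.comp_hasDerivAt t (aux_line x u t))
  have h2 := ((ContinuousMultilinearMap.apply ℝ (fun _ : Fin 2 => E) ℝ ![h, v]).hasFDerivAt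
    ).comp_hasDerivAt t h1
  rw [iteratedFDeriv_succ_apply_left]
  have e : (fun t : ℝ => ⟪hess (x + t • u) h, v⟫) =
      (⇑(ContinuousMultilinearMap.apply ℝ (fun _ : Fin 2 => E) ℝ ![h, v]) ∘
        iteratedFDeriv ℝ 2 f ∘ fun t : ℝ => x + t • u) := by
    funext s
    exact (aux_hess f g hg hess hhess _ h v).symm
  rw [e]
  exact h2

lemma aux_psd {E : Type*} [NormedAddCommGroup E] [InnerProductSpace ℝ E] [CompleteSpace E]
    (f : E → ℝ) (hf : ConvexOn ℝ Set.univ f) (g : E → E) (hg : ∀ y, HasGradientAt f (g y) y)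
    (hess : E → E →L[ℝ] E) (hhess : ∀ y, HasFDerivAt g (hess y) y) (y h : E) :
    0 ≤ ⟪hess y h, h⟫ := by
  have hd : ∀ t : ℝ, HasDerivAt (fun t : ℝ => f (y + t • h)) ⟪g (y + t • h), h⟫ t := by
    intro t
    have := (hg (y + t • h)).hasFDerivAt.comp_hasDerivAt t (aux_line y h t)
    simp only [InnerProductSpace.toDual_apply_apply] at this
    exact this
  have hc : ConvexOn ℝ Set.univ (fun t : ℝ => f (y + t • h)) := by
    refine ⟨convex_univ, fun a _ b _ c d hc hd hcd => ?_⟩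
    have := hf.2 (mem_univ (y + a • h)) (mem_univ (y + b • h)) hc hd hcd
    convert this using 2
    have : y = c • y + d • y := by rw [← add_smul, hcd, one_smul]
    nth_rw 1 [this]
    simp only [smul_add, add_smul, smul_smul, smul_eq_mul]
    abel
  have hm : MonotoneOn (deriv (fun t : ℝ => f (y + t • h))) Set.univ :=
    hc.monotoneOn_deriv (fun t _ => (hd t).differentiableAt)
  have he : deriv (fun t : ℝ => f (y + t • h)) = fun t => ⟪g (y + t • h), h⟫ :=
    funext fun t => (hd t).deriv
  rw [he] at hm
  have h3 := (aux_d1 g hess hhess y h h 0).deriv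
  have h4 : 0 ≤ deriv (fun t : ℝ => ⟪g (y + t • h), h⟫) 0 :=
    (monotoneOn_univ.1 hm).deriv_nonneg
  rw [h3] at h4
  simpa using h4

lemma aux_holder {E : Type*} [NormedAddCommGroup E] [InnerProductSpace ℝ E]
    (f : E → ℝ) (ν M : ℝ)
    (hHolder : ∀ y z : E,
      ‖iteratedFDeriv ℝ 3 f y - iteratedFDeriv ℝ 3 f z‖ ≤ M * ‖y - z‖ ^ ν) (y z u h v : E) :
    |iteratedFDeriv ℝ 3 f y ![u, h, v] - iteratedFDeriv ℝ 3 f z ![u, h, v]| ≤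
      M * ‖y - z‖ ^ ν * (‖u‖ * ‖h‖ * ‖v‖) := by
  have := (iteratedFDeriv ℝ 3 f y - iteratedFDeriv ℝ 3 f z).le_opNorm ![u, h, v]
  simp only [Fin.prod_univ_three] at this
  have h2 := this.trans (mul_le_mul_of_nonneg_right (hHolder y z) (by positivity))
  simpa using h2

lemma aux_exp2 {E : Type*} [NormedAddCommGroup E] [InnerProductSpace ℝ E] [CompleteSpace E]
    (f : E → ℝ) (hf3 : ContDiff ℝ 3 f) (g : E → E) (hg : ∀ y, HasGradientAt f (g y) y)
    (hess : E → E →L[ℝ] E) (hhess : ∀ y, HasFDerivAt g (hess y) y)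
    (ν M : ℝ) (hν : 0 ≤ ν) (hM : 0 ≤ M)
    (hHolder : ∀ y z : E,
      ‖iteratedFDeriv ℝ 3 f y - iteratedFDeriv ℝ 3 f z‖ ≤ M * ‖y - z‖ ^ ν) (x u h v : E) :
    |⟪hess (x + u) h, v⟫ - ⟪hess x h, v⟫ - iteratedFDeriv ℝ 3 f x ![u, h, v]| ≤
      M * ‖u‖ ^ ν * (‖u‖ * ‖h‖ * ‖v‖) := by
  have hd : ∀ t : ℝ, HasDerivAt
      (fun t : ℝ => ⟪hess (x + t • u) h, v⟫ - t * iteratedFDeriv ℝ 3 f x ![u, h, v])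
      (iteratedFDeriv ℝ 3 f (x + t • u) ![u, h, v] - iteratedFDeriv ℝ 3 f x ![u, h, v]) t := by
    intro t
    have := (aux_d2 f hf3 g hg hess hhess x u h v t).sub
      ((hasDerivAt_id t).mul_const (iteratedFDeriv ℝ 3 f x ![u, h, v]))
    simp only [one_mul] at this
    exact this
  have := norm_image_sub_le_of_norm_deriv_le_segment_01'
    (C := M * ‖u‖ ^ ν * (‖u‖ * ‖h‖ * ‖v‖))
    (fun t _ => (hd t).hasDerivWithinAt) (fun t ht => ?_)
  · rw [Real.norm_eq_abs] at this
    convert this using 2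
    simp
    ring
  · rw [Real.norm_eq_abs]
    refine (aux_holder f ν M hHolder _ _ u h v).trans ?_
    have : ‖x + t • u - x‖ ≤ ‖u‖ := by
      rw [add_sub_cancel_left, norm_smul, Real.norm_eq_abs, abs_of_nonneg ht.1]
      exact mul_le_of_le_one_left (norm_nonneg _) ht.2.le
    gcongr

lemma aux_exp1 {E : Type*} [NormedAddCommGroup E] [InnerProductSpace ℝ E] [CompleteSpace E]
    (f : E → ℝ) (hf3 : ContDiff ℝ 3 f) (g : E → E) (hg : ∀ y, HasGradientAt f (g y) y)
    (hess : E → E →L[ℝ] E) (hhess : ∀ y, HasFDerivAt g (hess y) y)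
    (ν M : ℝ) (hν : 0 ≤ ν) (hM : 0 ≤ M)
    (hHolder : ∀ y z : E,
      ‖iteratedFDeriv ℝ 3 f y - iteratedFDeriv ℝ 3 f z‖ ≤ M * ‖y - z‖ ^ ν) (x h v : E) :
    |⟪g (x + h), v⟫ - ⟪g x, v⟫ - ⟪hess x h, v⟫ - iteratedFDeriv ℝ 3 f x ![h, h, v] / 2| ≤
      M * ‖h‖ ^ ν * (‖h‖ * ‖h‖ * ‖v‖) := by
  have hd : ∀ t : ℝ, HasDerivAt
      (fun t : ℝ => ⟪g (x + t • h), v⟫ - t * ⟪hess x h, v⟫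
        - t ^ 2 * (iteratedFDeriv ℝ 3 f x ![h, h, v] / 2))
      (⟪hess (x + t • h) h, v⟫ - ⟪hess x h, v⟫ - t * iteratedFDeriv ℝ 3 f x ![h, h, v]) t := by
    intro t
    have := ((aux_d1 g hess hhess x h v t).sub
      ((hasDerivAt_id t).mul_const ⟪hess x h, v⟫)).sub
      ((hasDerivAt_pow 2 t).mul_const (iteratedFDeriv ℝ 3 f x ![h, h, v] / 2))
    refine (this : HasDerivAt _ _ _).congr_deriv ?_
    push_cast
    ring
  have := norm_image_sub_le_of_norm_deriv_le_segment_01'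
    (C := M * ‖h‖ ^ ν * (‖h‖ * ‖h‖ * ‖v‖))
    (fun t _ => (hd t).hasDerivWithinAt) (fun t ht => ?_)
  · rw [Real.norm_eq_abs] at this
    convert this using 2
    simp
    ring
  · rw [Real.norm_eq_abs]
    have h1 := aux_exp2 f hf3 g hg hess hhess ν M hν hM hHolder x (t • h) h v
    have h2 : iteratedFDeriv ℝ 3 f x ![t • h, h, v] = t * iteratedFDeriv ℝ 3 f x ![h, h, v] := by
      exact aux_smul _ _ _ _ _
    rw [h2] at h1
    refine h1.trans ?_
    have : ‖t • h‖ ≤ ‖h‖ := by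
      rw [norm_smul, Real.norm_eq_abs, abs_of_nonneg ht.1]
      exact mul_le_of_le_one_left (norm_nonneg _) ht.2.le
    gcongr

lemma aux_snd {E : Type*} [NormedAddCommGroup E] [InnerProductSpace ℝ E]
    (φ : E → ℝ) (hφ : ContDiff ℝ 2 φ) (x u h : E) :
    deriv (fun t : ℝ => fderiv ℝ φ (x + t • u) h) 0
      = deriv (fun t : ℝ => fderiv ℝ φ (x + t • h) u) 0 := by
  have hd : Differentiable ℝ (fderiv ℝ φ) :=
    (hφ.fderiv_right (m := 1) (by norm_num)).differentiable (by norm_num)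
  have key : ∀ u h : E, deriv (fun t : ℝ => fderiv ℝ φ (x + t • u) h) 0
      = fderiv ℝ (fderiv ℝ φ) x u h := by
    intro u h
    have h1 := (hd (x + (0 : ℝ) • u)).hasFDerivAt.comp_hasDerivAt 0 (aux_line x u 0)
    have h2 := h1.clm_apply (hasDerivAt_const (0 : ℝ) h)
    have h3 := h2.deriv
    simp only [Function.comp_def, map_zero, add_zero, zero_smul] at h3
    exact h3
  rw [key, key]
  exact (hφ.contDiffAt.isSymmSndFDerivAt (by simp)) u h

lemma aux_symm {E : Type*} [NormedAddCommGroup E] [InnerProductSpace ℝ E] [CompleteSpace E]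
    (f : E → ℝ) (hf3 : ContDiff ℝ 3 f) (g : E → E) (hg : ∀ y, HasGradientAt f (g y) y)
    (hess : E → E →L[ℝ] E) (hhess : ∀ y, HasFDerivAt g (hess y) y) (x h u : E) :
    iteratedFDeriv ℝ 3 f x ![h, h, u] = iteratedFDeriv ℝ 3 f x ![u, h, h] := by
  have hD : ∀ u h v : E, iteratedFDeriv ℝ 3 f x ![u, h, v]
      = deriv (fun t : ℝ => ⟪hess (x + t • u) h, v⟫) 0 := by
    intro u h v
    have := (aux_d2 f hf3 g hg hess hhess x u h v 0).deriv
    rw [this]; simp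
  have hf' : ∀ y v, fderiv ℝ f y v = ⟪g y, v⟫ := by
    intro y v
    rw [(hg y).hasFDerivAt.fderiv]; simp
  have s23 : ∀ y h v : E, ⟪hess y h, v⟫ = ⟪hess y v, h⟫ := by
    intro y h v
    have := aux_snd f (hf3.of_le (by norm_num)) y h v
    simp only [hf'] at this
    rw [(aux_d1 g hess hhess y h v 0).deriv, (aux_d1 g hess hhess y v h 0).deriv] at this
    simpa using this
  have s12 : ∀ u h v : E, iteratedFDeriv ℝ 3 f x ![u, h, v]
      = iteratedFDeriv ℝ 3 f x ![h, u, v] := by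
    intro u h v
    have hc : ContDiff ℝ 2 (fun y => ⟪g y, v⟫) := by
      have : ContDiff ℝ 2 (fun y => fderiv ℝ f y v) :=
        (hf3.fderiv_right (m := 2) (by norm_num)).clm_apply contDiff_const
      simpa only [hf'] using this
    have hc' : ∀ y w, fderiv ℝ (fun y => ⟪g y, v⟫) y w = ⟪hess y w, v⟫ := by
      intro y w
      have := (hhess y).inner ℝ (hasFDerivAt_const v y)
      rw [this.fderiv]
      simp
    have := aux_snd _ hc x u h
    simp only [hc'] at this
    rw [hD, hD, this]
  rw [s12 u h h, hD, hD]
  congr 1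
  funext t
  exact s23 _ _ _

/-- Main bound on the Taylor remainder of the gradient. -/
lemma aux_main {E : Type*} [NormedAddCommGroup E] [InnerProductSpace ℝ E] [CompleteSpace E]
    (f : E → ℝ) (hf : ConvexOn ℝ Set.univ f) (hf3 : ContDiff ℝ 3 f)
    (g : E → E) (hg : ∀ y, HasGradientAt f (g y) y)
    (hess : E → E →L[ℝ] E) (hhess : ∀ y, HasFDerivAt g (hess y) y)
    (ν M : ℝ) (hν : 0 ≤ ν) (hM : 0 ≤ M)
    (hHolder : ∀ y z : E,
      ‖iteratedFDeriv ℝ 3 f y - iteratedFDeriv ℝ 3 f z‖ ≤ M * ‖y - z‖ ^ ν) (x h : E)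
    (τ : ℝ) (hτ : 0 < τ) :
    ‖g (x + h) - g x - hess x h‖ ≤
      ⟪hess x h, h⟫ / (2 * τ) + M * τ ^ ν * ‖h‖ ^ 2 / 2 + M * ‖h‖ ^ ν * ‖h‖ ^ 2 := by
  set a := g (x + h) - g x - hess x h with ha
  have hB := aux_psd f hf g hg hess hhess x h
  by_cases h0 : a = 0
  · rw [h0, norm_zero]
    positivity
  have hn : 0 < ‖a‖ := norm_pos_iff.2 h0
  set v := ‖a‖⁻¹ • a with hv
  have hv1 : ‖v‖ = 1 := by
    rw [hv, norm_smul, norm_inv, norm_norm, inv_mul_cancel₀ hn.ne']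
  have hav : ⟪a, v⟫ = ‖a‖ := by
    rw [hv, inner_smul_right, real_inner_self_eq_norm_sq]
    field_simp
  have h1 := aux_exp1 f hf3 g hg hess hhess ν M hν hM hHolder x h v
  rw [aux_symm f hf3 g hg hess hhess] at h1
  have h2 := aux_exp2 f hf3 g hg hess hhess ν M hν hM hHolder x ((-τ) • v) h h
  have h3 : iteratedFDeriv ℝ 3 f x ![(-τ) • v, h, h]
      = (-τ) * iteratedFDeriv ℝ 3 f x ![v, h, h] := by
    exact aux_smul _ _ _ _ _
  have h4 := aux_psd f hf g hg hess hhess (x + (-τ) • v) h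
  have h5 : ‖(-τ) • v‖ = τ := by
    rw [norm_smul, hv1, norm_neg, Real.norm_eq_abs, abs_of_pos hτ, mul_one]
  rw [h3, h5] at h2
  rw [hv1] at h1
  set D := iteratedFDeriv ℝ 3 f x ![v, h, h]
  have h6 : ⟪g (x + h), v⟫ - ⟪g x, v⟫ - ⟪hess x h, v⟫ = ‖a‖ := by
    rw [← hav, ha, inner_sub_left, inner_sub_left]
  rw [h6] at h1
  have h7 := (abs_le.1 h1).2
  have h8 := (abs_le.1 h2).2
  have h9 : D ≤ ⟪hess x h, h⟫ / τ + M * τ ^ ν * ‖h‖ ^ 2 := by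
    rw [div_add' _ _ _ hτ.ne', le_div_iff₀ hτ]
    nlinarith
  have h10 : ⟪hess x h, h⟫ / (2 * τ) = (⟪hess x h, h⟫ / τ) / 2 := by
    field_simp
  rw [h10]
  nlinarith

lemma aux_pow (q M : ℝ) (hq1 : 3 ≤ q) (hq2 : q ≤ 4) (hM : 0 ≤ M) (gn : ℝ) (hgpos : 0 < gn)
    (α H : ℝ)
    (hH : ((6 : ℝ) ^ (q - 2) * M / ((4 : ℝ) ^ (q - 3) * (q - 2))) ^ ((1 : ℝ) / (q - 1)) *
        (1 / gn) ^ (α - (q - 2) / (q - 1)) ≤ H) :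
    0 ≤ H ∧ 3 * M * gn ^ (q - 2) ≤ (H * gn ^ α) ^ (q - 1) := by
  have hp : 0 < q - 2 := by linarith
  have hp1 : 0 < q - 1 := by linarith
  set K := (6 : ℝ) ^ (q - 2) * M / ((4 : ℝ) ^ (q - 3) * (q - 2)) with hK
  have hK0 : 0 ≤ K := by positivity
  have hH0 : 0 ≤ H := le_trans (by positivity) hH
  refine ⟨hH0, ?_⟩
  have h3 : 3 * M ≤ K := by
    rw [hK, le_div_iff₀ (by positivity)]
    have e : (6 : ℝ) ^ (q - 2) = 6 ^ (q - 3) * 6 := by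
      rw [← Real.rpow_add_one (by norm_num)]; congr 1; ring
    have l : (4 : ℝ) ^ (q - 3) ≤ 6 ^ (q - 3) :=
      Real.rpow_le_rpow (by norm_num) (by norm_num) (by linarith)
    have l0 : (0 : ℝ) < (4 : ℝ) ^ (q - 3) := by positivity
    have : 3 * ((4 : ℝ) ^ (q - 3) * (q - 2)) ≤ 6 ^ (q - 2) := by
      rw [e]; nlinarith
    nlinarith
  have h4 : K ^ ((1 : ℝ) / (q - 1)) * gn ^ ((q - 2) / (q - 1)) ≤ H * gn ^ α := by
    have := mul_le_mul_of_nonneg_right hH (Real.rpow_nonneg hgpos.le α)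
    refine le_trans (le_of_eq ?_) this
    rw [mul_assoc, one_div gn, Real.inv_rpow hgpos.le, ← Real.rpow_neg hgpos.le,
      ← Real.rpow_add hgpos]
    congr 2
    ring
  have h5 := Real.rpow_le_rpow (by positivity) h4 hp1.le
  rw [Real.mul_rpow (by positivity) (by positivity), ← Real.rpow_mul hK0,
    ← Real.rpow_mul hgpos.le, div_mul_cancel₀ _ hp1.ne', div_mul_cancel₀ _ hp1.ne',
    Real.rpow_one] at h5
  exact (mul_le_mul_of_nonneg_right h3 (by positivity)).trans h5

/-- Fix `3 ≤ q ≤ 4` and suppose the third derivative of the convex function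
`f` is Hölder continuous of degree `q - 3` with constant `M = M_q < ∞`. Let `s ∈ ∂ψ(x)` and
`g := ‖∇f(x) + s‖ > 0`. Choose `(q-2)/(q-1) ≤ α ≤ 1` and
`H ≥ (6^{q-2} M/(4^{q-3}(q-2)))^{1/(q-1)} · (1/g)^{α - (q-2)/(q-1)}`, set `λ := H·g^α`, and
let `T` be a regularized Newton step from `x` with parameter `λ`, with
`ψ'(T) = -∇f(x) - ∇²f(x)(T-x) - λ(T-x) ∈ ∂ψ(T)` and `F'(T) = ∇f(T) + ψ'(T)`.
Then `⟨F'(T), x - T⟩ ≥ ‖F'(T)‖² / (4λ)`. -/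
theorem statement_9 {E : Type*} [NormedAddCommGroup E] [InnerProductSpace ℝ E] [CompleteSpace E]
    (f ψ : E → ℝ) (hf : ConvexOn ℝ Set.univ f) (hψ : ConvexOn ℝ Set.univ ψ)
    (hf3 : ContDiff ℝ 3 f)
    (g : E → E) (hg : ∀ y, HasGradientAt f (g y) y)
    (hess : E → E →L[ℝ] E) (hhess : ∀ y, HasFDerivAt g (hess y) y)
    (q M : ℝ) (hq1 : 3 ≤ q) (hq2 : q ≤ 4) (hM : 0 ≤ M)
    (hHolder : ∀ y z : E,
      ‖iteratedFDeriv ℝ 3 f y - iteratedFDeriv ℝ 3 f z‖ ≤ M * ‖y - z‖ ^ (q - 3))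
    (x s : E) (hs : IsSubgradAt ψ s x)
    (gn : ℝ) (hgn : gn = ‖g x + s‖) (hgpos : 0 < gn)
    (α H : ℝ) (hα1 : (q - 2) / (q - 1) ≤ α) (hα2 : α ≤ 1)
    (hH : ((6 : ℝ) ^ (q - 2) * M / ((4 : ℝ) ^ (q - 3) * (q - 2))) ^ ((1 : ℝ) / (q - 1)) *
        (1 / gn) ^ (α - (q - 2) / (q - 1)) ≤ H)
    (lam : ℝ) (hlam : lam = H * gn ^ α)
    (T w : E) (hw : w = -(g x) - hess x (T - x) - lam • (T - x))
    (hT : IsSubgradAt ψ w T) :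
    ⟪g T + w, x - T⟫ ≥ ‖g T + w‖ ^ 2 / (4 * lam) := by
  obtain ⟨hH0, hpow⟩ := aux_pow q M hq1 hq2 hM gn hgpos α H hH
  rw [← hlam] at hpow
  have hlam0 : 0 ≤ lam := by rw [hlam]; positivity
  obtain ⟨h, hh⟩ : ∃ h, h = T - x := ⟨_, rfl⟩
  have hTx : T = x + h := by rw [hh]; abel
  have hxT : x - T = -h := by rw [hh]; abel
  rw [← hh] at hw
  have hν : 0 ≤ q - 3 := by linarith
  have key := aux_main f hf hf3 g hg hess hhess (q - 3) M hν hM hHolder x h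
  have hB := aux_psd f hf g hg hess hhess x h
  obtain ⟨a, ha⟩ : ∃ a, a = g (x + h) - g x - hess x h := ⟨_, rfl⟩
  rw [← ha] at key
  have hF : g T + w = a - lam • h := by
    rw [hw, ha, hTx]; abel
  -- step length bound
  have hstep : ⟪hess x h, h⟫ + lam * ‖h‖ ^ 2 ≤ gn * ‖h‖ := by
    have h1 := hs T
    have h2 := hT x
    rw [hxT] at h2
    rw [← hh] at h1
    rw [hw] at h2
    simp only [inner_neg_right, inner_sub_left, inner_neg_left, inner_smul_left,
      real_inner_self_eq_norm_sq] at h2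
    have h3 := real_inner_le_norm (-(g x + s)) h
    rw [norm_neg, ← hgn, inner_neg_left, inner_add_left] at h3
    simp at h2
    linarith
  rw [hF, hxT]
  rcases hlam0.eq_or_lt with h0 | hpos
  · -- degenerate case
    rw [← h0, Real.zero_rpow (by linarith)] at hpow
    have hM0 : M = 0 := by
      have : 0 < gn ^ (q - 2) := by positivity
      nlinarith
    have ha0 : ‖a‖ ≤ 0 := by
      refine le_of_forall_pos_le_add fun ε hε => ?_
      have := key ((⟪hess x h, h⟫ + 1) / (2 * ε)) (by positivity)
      rw [hM0] at this
      have e : ⟪hess x h, h⟫ / (2 * ((⟪hess x h, h⟫ + 1) / (2 * ε))) ≤ ε := by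
        rw [div_le_iff₀ (by positivity)]
        have : ε * (2 * ((⟪hess x h, h⟫ + 1) / (2 * ε))) = ⟪hess x h, h⟫ + 1 := by
          field_simp
        rw [this]; linarith
      linarith
    have : a = 0 := norm_le_zero_iff.1 ha0
    rw [this, ← h0]
    simp
  · have hr := norm_nonneg h
    have hbound : ‖a‖ ≤ lam * ‖h‖ := by
      obtain ⟨R, hR⟩ : ∃ R, R = gn / lam := ⟨_, rfl⟩
      have hRpos : 0 < R := by rw [hR]; positivity
      have hgR : gn = lam * R := by rw [hR]; field_simp
      have hrR : ‖h‖ ≤ R := by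
        rcases hr.eq_or_lt with hr0 | hr0
        · rw [← hr0]; exact hRpos.le
        · rw [hR, le_div_iff₀ hpos]
          nlinarith
      have hMR : 3 * (M * R ^ (q - 3) * R) ≤ lam := by
        have e1 : R ^ (q - 3) * R = R ^ (q - 2) := by
          rw [← Real.rpow_add_one hRpos.ne']; congr 1; ring
        have e2 : lam ^ (q - 1) = lam * lam ^ (q - 2) := by
          rw [mul_comm, ← Real.rpow_add_one hpos.ne']; congr 1; ring
        rw [hgR, Real.mul_rpow hpos.le hRpos.le, e2] at hpow
        rw [mul_assoc, e1]
        have : 0 < lam ^ (q - 2) := by positivity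
        refine le_of_mul_le_mul_right ?_ this
        linarith
      have k := key R hRpos
      have hpw : ‖h‖ ^ (q - 3) ≤ R ^ (q - 3) := Real.rpow_le_rpow hr hrR hν
      have k1 : M * ‖h‖ ^ (q - 3) * ‖h‖ ^ 2 ≤ M * R ^ (q - 3) * ‖h‖ ^ 2 := by gcongr
      have k2 : M * R ^ (q - 3) * ‖h‖ ^ 2 ≤ lam * ‖h‖ / 3 := by
        have : M * R ^ (q - 3) * ‖h‖ ^ 2 ≤ M * R ^ (q - 3) * (R * ‖h‖) := by
          rw [sq]; gcongr
        nlinarith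
      have k3 : ⟪hess x h, h⟫ / (2 * R) ≤ lam * ‖h‖ / 2 := by
        rw [div_le_iff₀ (by positivity)]
        rw [hgR] at hstep
        nlinarith [mul_nonneg hlam0 (sq_nonneg ‖h‖)]
      linarith
    rw [ge_iff_le, div_le_iff₀ (by positivity)]
    rw [norm_sub_sq_real, inner_neg_right, inner_sub_left, inner_smul_left, inner_smul_right,
      real_inner_self_eq_norm_sq, norm_smul, Real.norm_eq_abs, abs_of_pos hpos]
    simp only [conj_trivial]
    have hi := real_inner_le_norm a h
    have hna := norm_nonneg a
    have i1 : ⟪a, h⟫ * lam ≤ (lam * ‖h‖) ^ 2 := by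
      have : ‖a‖ * ‖h‖ ≤ lam * ‖h‖ * ‖h‖ := by gcongr
      nlinarith
    have i2 : ‖a‖ ^ 2 ≤ (lam * ‖h‖) ^ 2 := by gcongr
    nlinarith
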